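/- arXiv:2509.19095 — 2 statements merged into one kernel-verified Lean document; each statement's English description precedes it below -/
import Mathlib

section
/- In the setting of the modified algorithm (g = gcd(n, ℓ), 1 < g < ℓ, d = n/g, 1 ≤ k ≤ n/2, k = dr + c with c ∈ {−1,0,1}; the algorithm run with parameters n′ = dℓ, k′ = k, ℓ′ = ℓ and an enumeration in which the orbits of 1, …, g are the greatest; D′ = C \ (L_1 ∪ … ∪ L_{ℓ−g})): every I ∈ D′ is a subset of A = F([n]), and the collection D = {F⁻¹(I) : I ∈ D′} ⊆ C([n], k) is ρ^ℓ-symmetric, i.e., closed under I ↦ I +_n ℓ; indeed D is closed under I ↦ I +_n g, and g divides ℓ. -/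
open Finset

/-- `x +_n t`: add `t` to `x ∈ [n] = {1,…,n}` modulo `n`, with representative in `[n]`. -/
def shiftMod (n t x : ℕ) : ℕ := (x + t - 1) % n + 1

/-- `S +_n t`: add `t` to every element of `S ⊆ [n]` modulo `n`. -/
def shiftSet (n t : ℕ) (S : Finset ℕ) : Finset ℕ := S.image (shiftMod n t)

/-- `x +_n t` for an integer shift `t`. -/
def shiftModZ (n : ℕ) (t : ℤ) (x : ℕ) : ℕ := ((((x : ℤ) + t - 1) % (n : ℤ)) + 1).toNat

/-- `S +_n t` for an integer shift `t`. -/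
def shiftSetZ (n : ℕ) (t : ℤ) (S : Finset ℕ) : Finset ℕ := S.image (shiftModZ n t)

/-- Two sets `S`, `T` are weakly separated if there are no `a < b < c < d` with
`a, c ∈ S \ T` and `b, d ∈ T \ S`, nor with the roles of `S` and `T` exchanged. -/
def WeaklySeparated (S T : Finset ℕ) : Prop :=
  ¬ ∃ a b c d : ℕ, a < b ∧ b < c ∧ c < d ∧
    ((a ∈ S \ T ∧ c ∈ S \ T ∧ b ∈ T \ S ∧ d ∈ T \ S) ∨
     (a ∈ T \ S ∧ c ∈ T \ S ∧ b ∈ S \ T ∧ d ∈ S \ T))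

/-- The cyclic successor of `x` in a finite set `P ⊆ ℕ`: the least element of `P`
greater than `x` if one exists, and otherwise the least element of `P`. -/
def cyclicSucc (P : Finset ℕ) (x : ℕ) : ℕ :=
  if h : (P.filter (fun y => x < y)).Nonempty then (P.filter (fun y => x < y)).min' h
  else if h2 : P.Nonempty then P.min' h2 else 0

open scoped Classical in
/-- The cyclic interval of `P` from `u` to `v`:
`{u, S_P(u), …, S_P^m(u)}` where `m ≥ 0` is minimal with `S_P^m(u) = v`. -/
noncomputable def cyclicIntervalTo (P : Finset ℕ) (u v : ℕ) : Finset ℕ :=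
  if h : ∃ m : ℕ, (cyclicSucc P)^[m] u = v then
    (Finset.range (Nat.find h + 1)).image (fun j => (cyclicSucc P)^[j] u)
  else ∅

/-- The orbit `ā = {a + iℓ : 0 ≤ i ≤ d−1} ⊆ [dℓ]` of `a ∈ [ℓ]`. -/
def orbit (d ℓ a : ℕ) : Finset ℕ := (Finset.range d).image (fun i => a + i * ℓ)

/-- `P_s = [n] \ (ā_{a_1} ∪ … ∪ ā_{a_{s−1}})`, where `n = dℓ`. -/
def Pset (d ℓ : ℕ) (a : ℕ → ℕ) (s : ℕ) : Finset ℕ :=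
  Finset.Icc 1 (d * ℓ) \ (Finset.Icc 1 (s - 1)).biUnion (fun i => orbit d ℓ (a i))

/-- `P_{s,h} = P_s \ {a_s +_n hℓ, …, a_s +_n (d−1)ℓ}` for `1 ≤ h ≤ d−1`; `P_{s,d} = P_s`. -/
def Psh (d ℓ : ℕ) (a : ℕ → ℕ) (s h : ℕ) : Finset ℕ :=
  Pset d ℓ a s \ (Finset.Ico h d).image (fun j => shiftMod (d * ℓ) (j * ℓ) (a s))

/-- `I(i,h) = {i, S_{P_{s,h}}(i), S_{P_{s,h}}²(i), …, S_{P_{s,h}}^{k−1}(i)}`. -/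
def Iih (d ℓ k : ℕ) (a : ℕ → ℕ) (s h i : ℕ) : Finset ℕ :=
  (Finset.range k).image (fun j => (cyclicSucc (Psh d ℓ a s h))^[j] i)

/-- `B_s = {I(i,h) : i` in the cyclic interval of `P_s` from `S_{P_s}(a_s +_n (n−ℓ))` to
`a_s`, `1 ≤ h ≤ d`, `|I(i,h)| = k}`. -/
noncomputable def Bset (d ℓ k : ℕ) (a : ℕ → ℕ) (s : ℕ) : Finset (Finset ℕ) :=
  (((cyclicIntervalTo (Pset d ℓ a s)
        (cyclicSucc (Pset d ℓ a s) (shiftMod (d * ℓ) (d * ℓ - ℓ) (a s)))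
        (a s)) ×ˢ (Finset.Icc 1 d)).image
      (fun p => Iih d ℓ k a s p.2 p.1)).filter (fun I => I.card = k)

/-- `L_s = {I +_n xℓ : I ∈ B_s, 1 ≤ x ≤ d}`. -/
noncomputable def Lset (d ℓ k : ℕ) (a : ℕ → ℕ) (s : ℕ) : Finset (Finset ℕ) :=
  ((Bset d ℓ k a s) ×ˢ (Finset.Icc 1 d)).image (fun p => shiftSet (d * ℓ) (p.2 * ℓ) p.1)

/-- The output collection `D = L_1 ∪ … ∪ L_{ℓ−r+1}`. -/
noncomputable def Dcol (d ℓ k r : ℕ) (a : ℕ → ℕ) : Finset (Finset ℕ) :=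
  (Finset.Icc 1 (ℓ - r + 1)).biUnion (fun s => Lset d ℓ k a s)

/-- The map `F : [n] → [dℓ]`, `F(a + gx) = a + ℓx` for `1 ≤ a ≤ g`, `0 ≤ x ≤ d−1`. -/
def Fmap (g ℓ y : ℕ) : ℕ := (y - 1) % g + 1 + ℓ * ((y - 1) / g)

section Shift

theorem shiftMod_mem {n : ℕ} (hn : 1 ≤ n) (t x : ℕ) : shiftMod n t x ∈ Icc 1 n := by
  have := Nat.mod_lt (x + t - 1) hn
  simp only [shiftMod, mem_Icc]
  omega

theorem shiftMod_shiftMod {n s : ℕ} (t x : ℕ) (h : 1 ≤ x + s) :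
    shiftMod n t (shiftMod n s x) = shiftMod n (s + t) x := by
  simp only [shiftMod]
  rw [show (x + s - 1) % n + 1 + t - 1 = (x + s - 1) % n + t by omega, Nat.mod_add_mod,
    show x + s - 1 + t = x + (s + t) - 1 by omega]

theorem shiftMod_mul_self {n x : ℕ} (hx : x ∈ Icc 1 n) (m : ℕ) :
    shiftMod n (m * n) x = x := by
  rw [mem_Icc] at hx
  simp only [shiftMod]
  rw [show x + m * n - 1 = x - 1 + m * n by omega, Nat.add_mul_mod_self_right,
    Nat.mod_eq_of_lt (by omega)]
  omega

theorem shiftMod_injOn (n t : ℕ) : Set.InjOn (shiftMod n t) (Icc 1 n : Finset ℕ) := by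
  intro x hx y hy h
  simp only [coe_Icc, Set.mem_Icc] at hx hy
  simp only [shiftMod, Nat.add_right_cancel_iff] at h
  rw [show x + t - 1 = x - 1 + t by omega, show y + t - 1 = y - 1 + t by omega] at h
  have h' : (x - 1) ≡ (y - 1) [MOD n] := Nat.ModEq.add_right_cancel' t h
  have := h'.eq_of_lt_of_lt (by omega) (by omega)
  omega

theorem shiftSet_subset {n : ℕ} (hn : 1 ≤ n) (t : ℕ) (S : Finset ℕ) :
    shiftSet n t S ⊆ Icc 1 n :=
  image_subset_iff.2 fun x _ => shiftMod_mem hn t x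

theorem shiftSet_shiftSet {n s : ℕ} (t : ℕ) (S : Finset ℕ) (h : ∀ x ∈ S, 1 ≤ x + s) :
    shiftSet n t (shiftSet n s S) = shiftSet n (s + t) S := by
  simp only [shiftSet, image_image]
  exact image_congr fun x hx => shiftMod_shiftMod t x (h x hx)

theorem shiftSet_mul_self {n : ℕ} {S : Finset ℕ} (hS : S ⊆ Icc 1 n) (m : ℕ) :
    shiftSet n (m * n) S = S := by
  rw [shiftSet, image_congr (g := id) fun x hx => shiftMod_mul_self (hS hx) m, image_id]

theorem card_shiftSet {n : ℕ} {S : Finset ℕ} (hS : S ⊆ Icc 1 n) (t : ℕ) :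
    (shiftSet n t S).card = S.card :=
  card_image_of_injOn ((shiftMod_injOn n t).mono (by exact_mod_cast hS))

/-- A family of subsets of `[n]` closed under `I ↦ I +_n g` is closed under
`I ↦ I +_n mg`. -/
theorem shiftSet_mul_mem {n g : ℕ} {D : Finset (Finset ℕ)} (hD : ∀ I ∈ D, I ⊆ Icc 1 n)
    (h : ∀ I ∈ D, shiftSet n g I ∈ D) (m : ℕ) {I : Finset ℕ} (hI : I ∈ D) :
    shiftSet n (m * g) I ∈ D := by
  have hpos : ∀ x ∈ I, 1 ≤ x := fun x hx => (mem_Icc.1 (hD I hI hx)).1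
  induction m with
  | zero =>
    have := shiftSet_mul_self (hD I hI) 0
    rw [zero_mul] at this ⊢
    rwa [this]
  | succ m ih =>
    rw [add_mul, one_mul, ← shiftSet_shiftSet g I fun x hx => le_add_right (hpos x hx)]
    exact h _ ih

end Shift

section CyclicSucc

theorem cyclicSucc_mem {P : Finset ℕ} (hP : P.Nonempty) (x : ℕ) : cyclicSucc P x ∈ P := by
  unfold cyclicSucc
  split_ifs with h
  · exact filter_subset _ _ (min'_mem _ h)
  · exact min'_mem _ hP

theorem iterate_cyclicSucc_mem {P Q : Finset ℕ} (hP : P.Nonempty) (hPQ : P ⊆ Q) {x : ℕ}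
    (hx : x ∈ Q) (j : ℕ) : (cyclicSucc P)^[j] x ∈ Q := by
  cases j with
  | zero => exact hx
  | succ j =>
    rw [Function.iterate_succ_apply']
    exact hPQ (cyclicSucc_mem hP _)

theorem cyclicIntervalTo_subset {P : Finset ℕ} (hP : P.Nonempty) {u : ℕ} (hu : u ∈ P) (v : ℕ) :
    cyclicIntervalTo P u v ⊆ P := by
  unfold cyclicIntervalTo
  split_ifs with h
  · exact image_subset_iff.2 fun j _ => iterate_cyclicSucc_mem hP subset_rfl hu j
  · exact empty_subset _

theorem cyclicSucc_Icc {n x : ℕ} (hx : x ∈ Icc 1 n) :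
    cyclicSucc (Icc 1 n) x = shiftMod n 1 x := by
  rw [mem_Icc] at hx
  have hne : (Icc 1 n).Nonempty := nonempty_Icc.2 (by omega)
  simp only [cyclicSucc, shiftMod, Nat.add_sub_cancel]
  rcases hx.2.lt_or_eq with hlt | rfl
  · have h : ((Icc 1 n).filter fun y => x < y).Nonempty :=
      ⟨x + 1, by simp only [mem_filter, mem_Icc]; omega⟩
    rw [dif_pos h, Nat.mod_eq_of_lt hlt]
    apply le_antisymm
    · exact min'_le _ _ (by simp only [mem_filter, mem_Icc]; omega)
    · exact (mem_filter.1 (min'_mem _ h)).2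
  · have h : ¬ ((Icc 1 x).filter fun y => x < y).Nonempty := by
      rintro ⟨y, hy⟩
      simp only [mem_filter, mem_Icc] at hy
      omega
    rw [dif_neg h, dif_pos hne, Nat.mod_self]
    apply le_antisymm
    · exact min'_le _ _ (mem_Icc.2 (by omega))
    · exact (mem_Icc.1 (min'_mem _ hne)).1

theorem iterate_cyclicSucc_Icc {n x : ℕ} (hx : x ∈ Icc 1 n) (j : ℕ) :
    (cyclicSucc (Icc 1 n))^[j] x = shiftMod n j x := by
  have hx' := mem_Icc.1 hx
  induction j with
  | zero => simpa using (shiftMod_mul_self hx 0).symm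
  | succ j ih =>
    rw [Function.iterate_succ_apply', ih, cyclicSucc_Icc (shiftMod_mem (by omega) _ _),
      shiftMod_shiftMod 1 x (by omega)]

end CyclicSucc

section Algorithm

variable {d ℓ k s : ℕ} {a : ℕ → ℕ}

theorem mem_Pset_self (hd : 1 ≤ d) (ha : Set.BijOn a (Set.Icc 1 ℓ) (Set.Icc 1 ℓ))
    (hs : s ∈ Icc 1 ℓ) : a s ∈ Pset d ℓ a s := by
  rw [mem_Icc] at hs
  have has := ha.mapsTo (Set.mem_Icc.2 hs)
  rw [Set.mem_Icc] at has
  simp only [Pset, orbit, mem_sdiff, mem_Icc, mem_biUnion, mem_image, mem_range]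
  refine ⟨⟨has.1, has.2.trans (Nat.le_mul_of_pos_left ℓ hd)⟩, ?_⟩
  rintro ⟨i, hi, j, -, hij⟩
  have hi' : i ∈ Set.Icc 1 ℓ := Set.mem_Icc.2 (by omega)
  have hai := ha.mapsTo hi'
  rw [Set.mem_Icc] at hai
  have hj : j = 0 := by
    by_contra hj
    have := Nat.le_mul_of_pos_left ℓ (Nat.pos_of_ne_zero hj)
    omega
  rw [hj, zero_mul, add_zero] at hij
  have := ha.injOn hi' (Set.mem_Icc.2 hs) hij
  omega

theorem mem_Psh_self (hd : 1 ≤ d) (ha : Set.BijOn a (Set.Icc 1 ℓ) (Set.Icc 1 ℓ))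
    (hs : s ∈ Icc 1 ℓ) {h : ℕ} (hh : 1 ≤ h) : a s ∈ Psh d ℓ a s h := by
  have has := ha.mapsTo (Set.mem_Icc.2 (mem_Icc.1 hs))
  rw [Set.mem_Icc] at has
  rw [Psh, mem_sdiff]
  refine ⟨mem_Pset_self hd ha hs, ?_⟩
  simp only [mem_image, mem_Ico, shiftMod, not_exists, not_and]
  intro j hj hjs
  have h1 : (j + 1) * ℓ ≤ d * ℓ := Nat.mul_le_mul_right ℓ hj.2
  have h2 := Nat.le_mul_of_pos_left ℓ (show 0 < j by omega)
  rw [add_mul, one_mul] at h1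
  rw [Nat.mod_eq_of_lt (by omega)] at hjs
  omega

theorem Bset_subset_Pset (hd : 1 ≤ d) (ha : Set.BijOn a (Set.Icc 1 ℓ) (Set.Icc 1 ℓ))
    (hs : s ∈ Icc 1 ℓ) {I : Finset ℕ} (hI : I ∈ Bset d ℓ k a s) : I ⊆ Pset d ℓ a s := by
  simp only [Bset, mem_filter, mem_image, mem_product, Prod.exists, mem_Icc] at hI
  obtain ⟨⟨i, h, ⟨hi, hh⟩, rfl⟩, -⟩ := hI
  have hP : (Pset d ℓ a s).Nonempty := ⟨_, mem_Pset_self hd ha hs⟩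
  exact image_subset_iff.2 fun j _ => iterate_cyclicSucc_mem ⟨_, mem_Psh_self hd ha hs hh.1⟩
    sdiff_subset (cyclicIntervalTo_subset hP (cyclicSucc_mem hP _) _ hi) j

theorem shiftSet_mem_Lset_of_mem_Bset (hd : 1 ≤ d) (hl : 1 ≤ ℓ) {I : Finset ℕ}
    (hI : I ∈ Bset d ℓ k a s) {x : ℕ} (hx : 1 ≤ x) :
    shiftSet (d * ℓ) (x * ℓ) I ∈ Lset d ℓ k a s := by
  have hlt := Nat.mod_lt (x - 1) hd
  refine mem_image.2 ⟨(I, (x - 1) % d + 1), mem_product.2 ⟨hI, mem_Icc.2 ?_⟩, ?_⟩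
  · simp only
    omega
  · refine image_congr fun y _ => ?_
    have hx' : x * ℓ = ((x - 1) % d + 1) * ℓ + (x - 1) / d * (d * ℓ) := by
      conv_lhs => rw [← Nat.sub_add_cancel hx, ← Nat.mod_add_div (x - 1) d]
      ring
    have hpos : 1 ≤ ((x - 1) % d + 1) * ℓ := Nat.mul_pos (Nat.succ_pos _) hl
    simp only [shiftMod]
    rw [hx', ← add_assoc, Nat.sub_add_comm (le_add_left hpos), Nat.add_mul_mod_self_right]

theorem subset_Icc_of_mem_Lset (hd : 1 ≤ d) (hl : 1 ≤ ℓ) {I : Finset ℕ}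
    (hI : I ∈ Lset d ℓ k a s) : I ⊆ Icc 1 (d * ℓ) := by
  obtain ⟨p, -, rfl⟩ := mem_image.1 hI
  exact shiftSet_subset (Nat.mul_pos hd hl) _ _

theorem shiftSet_mem_Lset (hd : 1 ≤ d) (hl : 1 ≤ ℓ) {I : Finset ℕ}
    (hI : I ∈ Lset d ℓ k a s) (x : ℕ) : shiftSet (d * ℓ) (x * ℓ) I ∈ Lset d ℓ k a s := by
  obtain ⟨⟨J, y⟩, hp, rfl⟩ := mem_image.1 hI
  simp only [mem_product, mem_Icc] at hp
  have hpos : 1 ≤ y * ℓ := Nat.mul_pos hp.2.1 hl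
  rw [shiftSet_shiftSet _ _ fun z _ => le_add_left hpos, ← add_mul]
  exact shiftSet_mem_Lset_of_mem_Bset hd hl hp.1 (by omega)

theorem mem_Lset_of_shiftSet_mem_Lset (hd : 1 ≤ d) (hl : 1 ≤ ℓ) {I : Finset ℕ}
    (hI : I ⊆ Icc 1 (d * ℓ)) (h : shiftSet (d * ℓ) ℓ I ∈ Lset d ℓ k a s) :
    I ∈ Lset d ℓ k a s := by
  have h' := shiftSet_mem_Lset hd hl h (d - 1)
  have hdl : ℓ + (d - 1) * ℓ = 1 * (d * ℓ) := by
    obtain ⟨e, rfl⟩ := Nat.exists_eq_add_of_le hd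
    rw [Nat.add_sub_cancel_left]
    ring
  rwa [shiftSet_shiftSet _ _ fun z _ => le_add_left hl, hdl, shiftSet_mul_self hI] at h'

theorem card_of_mem_Lset (hd : 1 ≤ d) (ha : Set.BijOn a (Set.Icc 1 ℓ) (Set.Icc 1 ℓ))
    (hs : s ∈ Icc 1 ℓ) {I : Finset ℕ} (hI : I ∈ Lset d ℓ k a s) : I.card = k := by
  obtain ⟨⟨J, y⟩, hp, rfl⟩ := mem_image.1 hI
  have hJ := (mem_product.1 hp).1
  rw [card_shiftSet ((Bset_subset_Pset hd ha hs hJ).trans sdiff_subset)]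
  exact (mem_filter.1 hJ).2

theorem Pset_one : Pset d ℓ a 1 = Icc 1 (d * ℓ) := by simp [Pset]

theorem Iih_one (h i : ℕ) : Iih d ℓ 1 a s h i = {i} := by simp [Iih]

/-- For `k = 1` the first layer already consists of all singletons. -/
theorem singleton_mem_Lset_one (hd : 1 ≤ d) (hl : 1 ≤ ℓ) (ha1 : a 1 ∈ Icc 1 ℓ) {y : ℕ}
    (hy : y ∈ Icc 1 (d * ℓ)) : {y} ∈ Lset d ℓ 1 a 1 := by
  rw [mem_Icc] at ha1
  have hdl : 1 ≤ d * ℓ := Nat.mul_pos hd hl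
  have hle : ℓ ≤ d * ℓ := Nat.le_mul_of_pos_left ℓ hd
  have haw : a 1 ∈ Icc 1 (d * ℓ) := mem_Icc.2 ⟨ha1.1, ha1.2.trans hle⟩
  have hiter : ∀ m, (cyclicSucc (Icc 1 (d * ℓ)))^[m]
      (cyclicSucc (Icc 1 (d * ℓ)) (shiftMod (d * ℓ) (d * ℓ - ℓ) (a 1))) =
      shiftMod (d * ℓ) (d * ℓ - ℓ + (m + 1)) (a 1) := by
    intro m
    rw [← Function.iterate_succ_apply, iterate_cyclicSucc_Icc (shiftMod_mem hdl _ _),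
      shiftMod_shiftMod _ _ (by omega)]
  have hex : ∃ m, (cyclicSucc (Icc 1 (d * ℓ)))^[m]
      (cyclicSucc (Icc 1 (d * ℓ)) (shiftMod (d * ℓ) (d * ℓ - ℓ) (a 1))) = a 1 := by
    refine ⟨ℓ - 1, ?_⟩
    rw [hiter, show d * ℓ - ℓ + (ℓ - 1 + 1) = 1 * (d * ℓ) by omega, shiftMod_mul_self haw]
  have hmem : ∀ j < ℓ, shiftMod (d * ℓ) (d * ℓ - ℓ + (j + 1)) (a 1) ∈
      cyclicIntervalTo (Pset d ℓ a 1)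
        (cyclicSucc (Pset d ℓ a 1) (shiftMod (d * ℓ) (d * ℓ - ℓ) (a 1))) (a 1) := by
    intro j hj
    rw [Pset_one, cyclicIntervalTo, dif_pos hex]
    refine mem_image.2 ⟨j, mem_range.2 (hj.trans_le ?_), hiter j⟩
    rw [← Nat.sub_le_iff_le_add, Nat.le_find_iff]
    intro m hm h
    rw [hiter] at h
    rcases Nat.lt_or_ge (d * ℓ) (a 1 + (d * ℓ - ℓ + (m + 1))) with hlt | hge
    · rw [shiftMod, Nat.mod_eq_sub_mod (by omega), Nat.mod_eq_of_lt (by omega)] at h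
      omega
    · rw [shiftMod, Nat.mod_eq_of_lt (by omega)] at h
      omega
  rw [mem_Icc] at hy
  set N := y + (d * ℓ + ℓ) - a 1 - 1 with hN
  have hB : {shiftMod (d * ℓ) (d * ℓ - ℓ + (N % ℓ + 1)) (a 1)} ∈ Bset d ℓ 1 a 1 :=
    mem_filter.2 ⟨mem_image.2 ⟨(_, 1), mem_product.2 ⟨hmem _ (Nat.mod_lt _ hl),
      mem_Icc.2 ⟨le_rfl, hd⟩⟩, Iih_one _ _⟩, card_singleton _⟩
  have hq : 1 ≤ N / ℓ := (Nat.one_le_div_iff hl).2 (by omega)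
  have hL := shiftSet_mem_Lset_of_mem_Bset hd hl hB hq
  have hNd := Nat.mod_add_div' N ℓ
  rwa [shiftSet, image_singleton, shiftMod_shiftMod _ _ (by omega), shiftMod,
    show a 1 + (d * ℓ - ℓ + (N % ℓ + 1) + N / ℓ * ℓ) - 1 = y - 1 + 2 * (d * ℓ) by omega,
    Nat.add_mul_mod_self_right, Nat.mod_eq_of_lt (by omega), Nat.sub_add_cancel hy.1] at hL

end Algorithm

section Fmap

variable {d g ℓ : ℕ}

theorem Fmap_eq {b x : ℕ} (hb : b < g) : Fmap g ℓ (b + g * x + 1) = b + ℓ * x + 1 := by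
  rw [Fmap, Nat.add_sub_cancel, Nat.add_mul_mod_self_left, Nat.mod_eq_of_lt hb,
    Nat.add_mul_div_left _ _ (by omega), Nat.div_eq_of_lt hb, zero_add,
    add_right_comm]

theorem exists_eq_of_mem_Icc_mul {m : ℕ} (hm : 1 ≤ m) {y : ℕ} (hy : y ∈ Icc 1 (d * m)) :
    ∃ b < m, ∃ x < d, y = b + m * x + 1 := by
  rw [mem_Icc] at hy
  refine ⟨(y - 1) % m, Nat.mod_lt _ hm, (y - 1) / m, ?_, ?_⟩
  · exact (Nat.div_lt_iff_lt_mul hm).2 (by omega)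
  · have := Nat.mod_add_div (y - 1) m
    omega

theorem shiftMod_block {m b : ℕ} (hb : b < m) (x : ℕ) :
    shiftMod (d * m) m (b + m * x + 1) = b + m * ((x + 1) % d) + 1 := by
  rw [shiftMod, show b + m * x + 1 + m - 1 = b + m * (x + 1) by rw [mul_add]; omega,
    mul_comm d m, Nat.mod_mul, Nat.add_mul_mod_self_left, Nat.mod_eq_of_lt hb,
    Nat.add_mul_div_left _ _ (by omega), Nat.div_eq_of_lt hb, zero_add]

theorem Fmap_shiftMod (hg : 1 ≤ g) (hgl : g ≤ ℓ) {y : ℕ} (hy : y ∈ Icc 1 (d * g)) :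
    Fmap g ℓ (shiftMod (d * g) g y) = shiftMod (d * ℓ) ℓ (Fmap g ℓ y) := by
  obtain ⟨b, hb, x, -, rfl⟩ := exists_eq_of_mem_Icc_mul hg hy
  rw [shiftMod_block hb, Fmap_eq hb, Fmap_eq hb, shiftMod_block (hb.trans_le hgl)]

theorem Fmap_injOn (hg : 1 ≤ g) (hgl : g ≤ ℓ) :
    Set.InjOn (Fmap g ℓ) (Icc 1 (d * g) : Finset ℕ) := by
  intro y hy z hz h
  obtain ⟨b, hb, x, -, rfl⟩ := exists_eq_of_mem_Icc_mul hg (mem_coe.1 hy)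
  obtain ⟨b', hb', x', -, rfl⟩ := exists_eq_of_mem_Icc_mul hg (mem_coe.1 hz)
  rw [Fmap_eq hb, Fmap_eq hb', Nat.add_right_cancel_iff] at h
  have hmod := congrArg (· % ℓ) h
  simp only [Nat.add_mul_mod_self_left, Nat.mod_eq_of_lt (hb.trans_le hgl),
    Nat.mod_eq_of_lt (hb'.trans_le hgl)] at hmod
  subst hmod
  rw [Nat.eq_of_mul_eq_mul_left (hg.trans hgl) (Nat.add_left_cancel h)]

theorem shiftMod_mem_image_Fmap (hd : 1 ≤ d) (hg : 1 ≤ g) (hgl : g ≤ ℓ) {z : ℕ}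
    (hz : z ∈ (Icc 1 (d * g)).image (Fmap g ℓ)) :
    shiftMod (d * ℓ) ℓ z ∈ (Icc 1 (d * g)).image (Fmap g ℓ) := by
  obtain ⟨y, hy, rfl⟩ := mem_image.1 hz
  exact mem_image.2 ⟨_, shiftMod_mem (Nat.mul_pos hd hg) g y, Fmap_shiftMod hg hgl hy⟩

theorem shiftMod_mul_mem_image_Fmap (hd : 1 ≤ d) (hg : 1 ≤ g) (hgl : g ≤ ℓ) {z : ℕ}
    (hz : z ∈ (Icc 1 (d * g)).image (Fmap g ℓ)) {x : ℕ} (hx : 1 ≤ x) :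
    shiftMod (d * ℓ) (x * ℓ) z ∈ (Icc 1 (d * g)).image (Fmap g ℓ) := by
  induction x, hx using Nat.le_induction with
  | base => simpa using shiftMod_mem_image_Fmap hd hg hgl hz
  | succ x hx ih =>
    have hpos : 1 ≤ x * ℓ := Nat.mul_pos hx (hg.trans hgl)
    rw [add_mul, one_mul, ← shiftMod_shiftMod ℓ z (by omega)]
    exact shiftMod_mem_image_Fmap hd hg hgl ih

/-- The preimage `F⁻¹(I) ⊆ [dg]` has as many elements as `I ⊆ F([dg])`. -/
theorem card_preimage_Fmap (hg : 1 ≤ g) (hgl : g ≤ ℓ) {I : Finset ℕ}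
    (hI : I ⊆ (Icc 1 (d * g)).image (Fmap g ℓ)) :
    ((Icc 1 (d * g)).filter fun y => Fmap g ℓ y ∈ I).card = I.card := by
  rw [← card_image_of_injOn ((Fmap_injOn (d := d) hg hgl).mono
    (by exact_mod_cast filter_subset _ _))]
  congr 1
  ext z
  simp only [mem_image, mem_filter]
  constructor
  · rintro ⟨y, ⟨-, hy⟩, rfl⟩
    exact hy
  · intro hz
    obtain ⟨y, hy, rfl⟩ := mem_image.1 (hI hz)
    exact ⟨y, ⟨hy, hz⟩, rfl⟩

theorem shiftSet_preimage_Fmap (hd : 1 ≤ d) (hg : 1 ≤ g) (hgl : g ≤ ℓ) {I : Finset ℕ}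
    (hI : I ⊆ (Icc 1 (d * g)).image (Fmap g ℓ)) :
    shiftSet (d * g) g ((Icc 1 (d * g)).filter fun y => Fmap g ℓ y ∈ I) =
      (Icc 1 (d * g)).filter fun y => Fmap g ℓ y ∈ shiftSet (d * ℓ) ℓ I := by
  have hmem := shiftMod_mem (Nat.mul_pos hd hg) g
  ext y
  constructor
  · intro hy
    obtain ⟨x, hx, rfl⟩ := mem_image.1 hy
    rw [mem_filter] at hx
    refine mem_filter.2 ⟨hmem x, ?_⟩
    rw [Fmap_shiftMod hg hgl hx.1]
    exact mem_image_of_mem _ hx.2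
  · intro hy
    obtain ⟨hy, hyI⟩ := mem_filter.1 hy
    obtain ⟨z, hz, hzy⟩ := mem_image.1 hyI
    obtain ⟨x, hx, rfl⟩ := mem_image.1 (hI hz)
    rw [← Fmap_shiftMod hg hgl hx] at hzy
    exact mem_image.2 ⟨x, mem_filter.2 ⟨hx, hz⟩,
      Fmap_injOn hg hgl (mem_coe.2 (hmem x)) (mem_coe.2 hy) hzy⟩

theorem Pset_subset_image_Fmap {s : ℕ} {a : ℕ → ℕ} (hl : 1 ≤ ℓ)
    (ha : Set.BijOn a (Set.Icc 1 ℓ) (Set.Icc 1 ℓ))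
    (hag : (Icc (ℓ - g + 1) ℓ).image a = Icc 1 g) (hs : ℓ - g < s) :
    Pset d ℓ a s ⊆ (Icc 1 (d * g)).image (Fmap g ℓ) := by
  intro y hy
  obtain ⟨hy, hyo⟩ := mem_sdiff.1 hy
  obtain ⟨b, hb, x, hx, rfl⟩ := exists_eq_of_mem_Icc_mul hl hy
  obtain ⟨i, hi, hib⟩ := ha.surjOn (Set.mem_Icc.2 ⟨Nat.succ_pos b, hb⟩)
  rw [Set.mem_Icc] at hi
  have his : ℓ - g + 1 ≤ i := by
    by_contra hlt
    refine hyo (mem_biUnion.2 ⟨i, mem_Icc.2 (by omega),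
      mem_image.2 ⟨x, mem_range.2 hx, ?_⟩⟩)
    rw [hib, mul_comm]
    omega
  have hbg : a i ∈ Icc 1 g := hag ▸ mem_image_of_mem a (mem_Icc.2 ⟨his, hi.2⟩)
  rw [hib, mem_Icc] at hbg
  refine mem_image.2 ⟨b + g * x + 1, mem_Icc.2 ⟨Nat.succ_pos _, ?_⟩, Fmap_eq hbg.2⟩
  have : g * (x + 1) ≤ g * d := Nat.mul_le_mul_left g hx
  rw [mul_add, mul_one, mul_comm g d] at this
  omega

end Fmap

/-- In the setting of the modified algorithm (`g = gcd(n, ℓ)`,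
`1 < g < ℓ`, `d = n/g`, `1 ≤ k ≤ n/2`, `k = dr + c` with `c ∈ {−1,0,1}`; the algorithm
run with parameters `n′ = dℓ`, `k′ = k`, `ℓ′ = ℓ` and an enumeration in which the orbits
of `1, …, g` are the greatest; `D′ = C \ (L_1 ∪ … ∪ L_{ℓ−g})`): every `I ∈ D′` is a
subset of `A = F([n])`, and the collection `D = {F⁻¹(I) : I ∈ D′} ⊆ C([n], k)` is
`ρ^ℓ`-symmetric; indeed `D` is closed under `I ↦ I +_n g`, and `g` divides `ℓ`. -/
theorem stmt17 (n k ℓ : ℕ) (hn : 1 ≤ n) (hk1 : 1 ≤ k) (hl : 1 ≤ ℓ)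
    (g : ℕ) (hg : g = Nat.gcd n ℓ) (hg1 : 1 < g) (hg2 : g < ℓ)
    (d : ℕ) (hdd : d = n / g) (hk2 : 2 * k ≤ n)
    (r : ℕ) (c : ℤ) (hc : c = -1 ∨ c = 0 ∨ c = 1) (hk : (k : ℤ) = d * r + c)
    (a : ℕ → ℕ) (ha : Set.BijOn a (Set.Icc 1 ℓ) (Set.Icc 1 ℓ))
    (hag : (Finset.Icc (ℓ - g + 1) ℓ).image a = Finset.Icc 1 g)
    (A : Finset ℕ) (hA : A = (Finset.Icc 1 n).image (Fmap g ℓ))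
    (D' : Finset (Finset ℕ))
    (hD' : D' = Dcol d ℓ k r a \ (Finset.Icc 1 (ℓ - g)).biUnion (fun s => Lset d ℓ k a s))
    (D : Finset (Finset ℕ))
    (hD : D = D'.image (fun I => (Finset.Icc 1 n).filter (fun y => Fmap g ℓ y ∈ I))) :
    (∀ I ∈ D', I ⊆ A) ∧
      (∀ I ∈ D, I ⊆ Finset.Icc 1 n ∧ I.card = k) ∧
      (∀ I ∈ D, shiftSet n ℓ I ∈ D) ∧
      (∀ I ∈ D, shiftSet n g I ∈ D) ∧
      g ∣ ℓ := by
  have hgn : g ∣ n := hg ▸ Nat.gcd_dvd_left n ℓ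
  have hgl : g ∣ ℓ := hg ▸ Nat.gcd_dvd_right n ℓ
  have hgpos : 1 ≤ g := hg1.le
  have hnd : n = d * g := by rw [hdd, Nat.div_mul_cancel hgn]
  have hd : 1 ≤ d := by
    rcases Nat.eq_zero_or_pos d with rfl | h
    · omega
    · exact h
  subst hnd hA
  have hlayer : ∀ I ∈ D', ∃ s, s ∈ Icc 1 ℓ ∧ s ≤ ℓ - r + 1 ∧ ℓ - g < s ∧
      I ∈ Lset d ℓ k a s := by
    intro I hI
    simp only [hD', Dcol, mem_sdiff, mem_biUnion, not_exists, not_and] at hI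
    obtain ⟨⟨s, hs, hIs⟩, hnot⟩ := hI
    have hs' := mem_Icc.1 hs
    have hsg : ℓ - g < s := by
      by_contra hlt
      exact hnot s (mem_Icc.2 (by omega)) hIs
    refine ⟨s, mem_Icc.2 ⟨hs'.1, ?_⟩, hs'.2, hsg, hIs⟩
    by_contra hsl
    -- Only `r = 0`, hence `k = 1`, allows `s = ℓ + 1`.
    have hr : r = 0 := by omega
    have hk' : k = 1 := by
      rw [hr] at hk
      simp only [Nat.cast_zero, mul_zero, zero_add] at hk
      omega
    subst hk'
    obtain ⟨⟨J, x⟩, hp, rfl⟩ := mem_image.1 hIs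
    obtain ⟨⟨i, h⟩, -, rfl⟩ := mem_image.1 (mem_filter.1 (mem_product.1 hp).1).1
    refine hnot 1 (mem_Icc.2 (by omega)) ?_
    simp only [Iih_one, shiftSet, image_singleton]
    exact singleton_mem_Lset_one hd hl
      (mem_Icc.2 (Set.mem_Icc.1 (ha.mapsTo (Set.mem_Icc.2 ⟨le_rfl, hl⟩))))
      (shiftMod_mem (Nat.mul_pos hd hl) _ _)
  have hsub : ∀ I ∈ D', I ⊆ (Icc 1 (d * g)).image (Fmap g ℓ) := by
    intro I hI
    obtain ⟨s, hs, -, hsg, hIs⟩ := hlayer I hI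
    obtain ⟨⟨J, x⟩, hp, rfl⟩ := mem_image.1 hIs
    obtain ⟨hJ, hx⟩ := mem_product.1 hp
    exact image_subset_iff.2 fun z hz => shiftMod_mul_mem_image_Fmap hd hgpos hg2.le
      (Pset_subset_image_Fmap hl ha hag hsg (Bset_subset_Pset hd ha hs hJ hz)) (mem_Icc.1 hx).1
  have hshift : ∀ I ∈ D', shiftSet (d * ℓ) ℓ I ∈ D' := by
    intro I hI
    obtain ⟨s, hs, hsr, -, hIs⟩ := hlayer I hI
    have hI' := hI
    simp only [hD', Dcol, mem_sdiff, mem_biUnion, not_exists, not_and] at hI' ⊢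
    refine ⟨⟨s, mem_Icc.2 ⟨(mem_Icc.1 hs).1, hsr⟩, ?_⟩, fun t ht h => hI'.2 t ht ?_⟩
    · simpa using shiftSet_mem_Lset hd hl hIs 1
    · exact mem_Lset_of_shiftSet_mem_Lset hd hl (subset_Icc_of_mem_Lset hd hl hIs) h
  have hDsub : ∀ I ∈ D, I ⊆ Icc 1 (d * g) ∧ I.card = k := by
    intro I hI
    rw [hD] at hI
    obtain ⟨J, hJ, rfl⟩ := mem_image.1 hI
    obtain ⟨s, hs, -, -, hJs⟩ := hlayer J hJ
    exact ⟨filter_subset _ _,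
      (card_preimage_Fmap hgpos hg2.le (hsub J hJ)).trans (card_of_mem_Lset hd ha hs hJs)⟩
  have hDg : ∀ I ∈ D, shiftSet (d * g) g I ∈ D := by
    intro I hI
    rw [hD] at hI ⊢
    obtain ⟨J, hJ, rfl⟩ := mem_image.1 hI
    rw [shiftSet_preimage_Fmap hd hgpos hg2.le (hsub J hJ)]
    exact mem_image_of_mem _ (hshift J hJ)
  refine ⟨hsub, hDsub, fun I hI => ?_, hDg, hgl⟩
  rw [← Nat.div_mul_cancel hgl]
  exact shiftSet_mul_mem (fun J hJ => (hDsub J hJ).1) hDg _ hI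
end

section
/- With the algorithm setup (n = dℓ): for every 1 ≤ s ≤ ℓ and every x ∈ P_s, applying the cyclic successor of P_s exactly ℓ − s + 1 times to x yields x +_n ℓ, i.e., S_{P_s}^{ℓ−s+1}(x) = x +_n ℓ. -/
open Finset

theorem cyclicSucc_eq_of_lt {P : Finset ℕ} {y z : ℕ} (hz : z ∈ P) (hyz : y < z)
    (hmin : ∀ w ∈ P, y < w → z ≤ w) : cyclicSucc P y = z := by
  have hz' : z ∈ P.filter (fun w => y < w) := by simp [hz, hyz]
  rw [cyclicSucc, dif_pos ⟨z, hz'⟩]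
  refine le_antisymm (Finset.min'_le _ _ hz') (Finset.le_min' _ _ _ fun w hw => ?_)
  rw [Finset.mem_filter] at hw
  exact hmin w hw.1 hw.2

theorem cyclicSucc_eq_of_forall_le {P : Finset ℕ} {y z : ℕ} (hz : z ∈ P)
    (hmax : ∀ w ∈ P, w ≤ y) (hmin : ∀ w ∈ P, z ≤ w) : cyclicSucc P y = z := by
  have hne : ¬ (P.filter (fun w => y < w)).Nonempty := by
    rintro ⟨w, hw⟩
    rw [Finset.mem_filter] at hw
    exact absurd (hmax w hw.1) (not_le.2 hw.2)
  rw [cyclicSucc, dif_neg hne, dif_pos ⟨z, hz⟩]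
  exact le_antisymm (Finset.min'_le _ _ hz) (Finset.le_min' _ _ _ hmin)

section Periodic

variable {p : ℕ → Prop} {n : ℕ} {P : Finset ℕ}

/-- If `P` is a full period `[n]` of a periodic predicate (shifted by one), the cyclic successor
in `P` is the reduction modulo `n` of the next natural number satisfying the predicate. -/
theorem cyclicSucc_mod_add_one (hn : 0 < n) (hp : Function.Periodic p n)
    (hP : ∀ y, y ∈ P ↔ 1 ≤ y ∧ y ≤ n ∧ p (y - 1)) {y z : ℕ} (hy : p y) (hz : p z) (hyz : y < z)
    (hnext : ∀ w, p w → y < w → z ≤ w) : cyclicSucc P (y % n + 1) = z % n + 1 := by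
  have hadd : ∀ q w, p (w + n * q) ↔ p w := fun q w => by
    have := hp.nat_mul q w
    rw [Nat.cast_id, mul_comm] at this
    exact iff_of_eq this
  have hmod : ∀ w, p (w % n) ↔ p w := fun w => by
    rw [← hadd (w / n) (w % n), Nat.mod_add_div]
  have hlt := Nat.mod_lt y hn
  have hydiv := Nat.mod_add_div y n
  obtain ⟨u, hu⟩ : ∃ u, z = u + n * (y / n) := ⟨z - n * (y / n), by omega⟩
  have hzu : z % n = u % n := by rw [hu, Nat.add_mul_mod_self_left]
  have hpu : p u := (hadd _ u).1 (hu ▸ hz)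
  have hyu : y % n < u := by omega
  have hnext' : ∀ w, p w → y % n < w → u ≤ w := fun w hw hlw => by
    have := hnext (w + n * (y / n)) ((hadd _ w).2 hw) (by omega)
    omega
  rw [hzu]
  rcases lt_or_ge u n with hun | hun
  · rw [Nat.mod_eq_of_lt hun]
    refine cyclicSucc_eq_of_lt ((hP _).2 ⟨by omega, hun, hpu⟩) (by omega) fun w hw hlw => ?_
    obtain ⟨h1, -, hpw⟩ := (hP w).1 hw
    have := hnext' (w - 1) hpw (by omega)
    omega
  · have hle : u ≤ y % n + n := hnext' _ ((hp (y % n)).symm ▸ (hmod y).2 hy) (by omega)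
    have hun' : u % n = u - n := by
      rw [Nat.mod_eq_sub_mod hun, Nat.mod_eq_of_lt (by omega)]
    refine cyclicSucc_eq_of_forall_le
      ((hP _).2 ⟨by omega, Nat.mod_lt u hn, (hmod u).2 hpu⟩) (fun w hw => ?_) (fun w hw => ?_)
    · obtain ⟨h1, h2, hpw⟩ := (hP w).1 hw
      by_contra hcon
      have := hnext' (w - 1) hpw (by omega)
      omega
    · obtain ⟨h1, h2, hpw⟩ := (hP w).1 hw
      have := hnext' (w - 1 + n) ((hp (w - 1)).symm ▸ hpw) (by omega)
      omega

theorem cyclicSucc_iterate_nth (hn : 0 < n) (hp : Function.Periodic p n)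
    (hinf : {y | p y}.Infinite) (hP : ∀ y, y ∈ P ↔ 1 ≤ y ∧ y ≤ n ∧ p (y - 1)) (j k : ℕ) :
    (cyclicSucc P)^[k] (Nat.nth p j % n + 1) = Nat.nth p (j + k) % n + 1 := by
  classical
  induction k with
  | zero => rfl
  | succ k ih =>
    rw [Function.iterate_succ_apply', ih, ← add_assoc]
    refine cyclicSucc_mod_add_one hn hp hP (Nat.nth_mem_of_infinite hinf _)
      (Nat.nth_mem_of_infinite hinf _) (Nat.nth_strictMono hinf (Nat.lt_succ_self _))
      fun w hw hlt => ?_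
    rw [← Nat.nth_count hw] at hlt ⊢
    exact (Nat.nth_strictMono hinf).monotone ((Nat.nth_strictMono hinf).lt_iff_lt.1 hlt)

end Periodic

theorem Function.Periodic.infinite_setOf {p : ℕ → Prop} {n : ℕ} (hp : Function.Periodic p n)
    (hn : 0 < n) {y : ℕ} (hy : p y) : {y | p y}.Infinite := by
  refine Set.infinite_of_forall_exists_gt fun b => ⟨y + (b + 1) * n, ?_, ?_⟩
  · have := hp.nat_mul (b + 1) y
    rw [Nat.cast_id] at this
    exact this.mpr hy
  · nlinarith

theorem Function.Periodic.count_add {p : ℕ → Prop} [DecidablePred p] {n : ℕ}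
    (hp : Function.Periodic p n) (y : ℕ) :
    Nat.count p (y + n) = Nat.count p y + Nat.count p n := by
  rw [add_comm y n, Nat.count_add, add_comm]
  congr 2
  funext k
  rw [add_comm, hp]

theorem mem_orbit_iff {d ℓ b y : ℕ} (hb : b ∈ Set.Icc 1 ℓ) :
    y ∈ orbit d ℓ b ↔ 1 ≤ y ∧ y ≤ d * ℓ ∧ (y - 1) % ℓ + 1 = b := by
  obtain ⟨hb1, hb2⟩ := hb
  simp only [orbit, Finset.mem_image, Finset.mem_range]
  constructor
  · rintro ⟨i, hi, rfl⟩
    have : (i + 1) * ℓ ≤ d * ℓ := Nat.mul_le_mul_right _ hi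
    refine ⟨by omega, by linarith, ?_⟩
    rw [show b + i * ℓ - 1 = b - 1 + i * ℓ by omega, Nat.add_mul_mod_self_right,
      Nat.mod_eq_of_lt (by omega)]
    omega
  · rintro ⟨h1, h2, h3⟩
    refine ⟨(y - 1) / ℓ, (Nat.div_lt_iff_lt_mul (by omega)).2 (by omega), ?_⟩
    have := Nat.mod_add_div' (y - 1) ℓ
    omega

theorem mem_Pset_iff {d ℓ s : ℕ} {a : ℕ → ℕ} (ha : Set.MapsTo a (Set.Icc 1 ℓ) (Set.Icc 1 ℓ))
    (hs : s ≤ ℓ) (y : ℕ) :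
    y ∈ Pset d ℓ a s ↔
      1 ≤ y ∧ y ≤ d * ℓ ∧ (y - 1) % ℓ + 1 ∉ (Finset.Icc 1 (s - 1)).image a := by
  have horbit : ∀ i ∈ Finset.Icc 1 (s - 1),
      (y ∈ orbit d ℓ (a i) ↔ 1 ≤ y ∧ y ≤ d * ℓ ∧ (y - 1) % ℓ + 1 = a i) := fun i hi => by
    rw [Finset.mem_Icc] at hi
    exact mem_orbit_iff (ha ⟨hi.1, by omega⟩)
  simp only [Pset, Finset.mem_sdiff, Finset.mem_biUnion, Finset.mem_image, Finset.mem_Icc] at *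
  grind

theorem count_mod_add_one_notMem {ℓ : ℕ} {A : Finset ℕ} (hA : A ⊆ Finset.Icc 1 ℓ) :
    Nat.count (fun y => y % ℓ + 1 ∉ A) ℓ = ℓ - A.card := by
  have hcard : (Finset.Icc 1 ℓ \ A).card = ℓ - A.card := by
    rw [Finset.card_sdiff_of_subset hA, Nat.card_Icc, Nat.add_sub_cancel]
  rw [Nat.count_eq_card_filter_range, ← hcard]
  refine Finset.card_bij (fun y _ => y + 1) (fun y hy => ?_) (fun _ _ _ _ h => by omega)
    fun z hz => ⟨z - 1, ?_, ?_⟩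
  · rw [Finset.mem_filter, Finset.mem_range] at hy
    rw [Nat.mod_eq_of_lt hy.1] at hy
    simp only [Finset.mem_sdiff, Finset.mem_Icc]
    exact ⟨by omega, hy.2⟩
  · simp only [Finset.mem_sdiff, Finset.mem_Icc] at hz
    rw [Finset.mem_filter, Finset.mem_range, Nat.mod_eq_of_lt (by omega),
      Nat.sub_add_cancel hz.1.1]
    exact ⟨by omega, hz.2⟩
  · simp only [Finset.mem_sdiff, Finset.mem_Icc] at hz
    omega

/-- With the algorithm setup (`n = dℓ`): for every `1 ≤ s ≤ ℓ` and
every `x ∈ P_s`, applying the cyclic successor of `P_s` exactly `ℓ − s + 1` times to `x`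
yields `x +_n ℓ`. -/
theorem stmt19 (d ℓ : ℕ) (hd : 1 ≤ d) (hl : 1 ≤ ℓ)
    (a : ℕ → ℕ) (ha : Set.BijOn a (Set.Icc 1 ℓ) (Set.Icc 1 ℓ))
    (s : ℕ) (hs1 : 1 ≤ s) (hs2 : s ≤ ℓ)
    (x : ℕ) (hx : x ∈ Pset d ℓ a s) :
    (cyclicSucc (Pset d ℓ a s))^[ℓ - s + 1] x = shiftMod (d * ℓ) ℓ x := by
  set A := (Finset.Icc 1 (s - 1)).image a with hA
  set p : ℕ → Prop := fun y => y % ℓ + 1 ∉ A with hp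
  have hP : ∀ y, y ∈ Pset d ℓ a s ↔ 1 ≤ y ∧ y ≤ d * ℓ ∧ p (y - 1) := mem_Pset_iff ha.mapsTo hs2
  have hper : Function.Periodic p ℓ := fun y => by simp only [hp, Nat.add_mod_right]
  have hpern : Function.Periodic p (d * ℓ) := fun y => by
    simp only [hp, Nat.add_mul_mod_self_right]
  have hsub : (↑(Finset.Icc 1 (s - 1)) : Set ℕ) ⊆ Set.Icc 1 ℓ := fun i hi => by
    rw [Finset.mem_coe, Finset.mem_Icc] at hi
    exact ⟨hi.1, by omega⟩
  have hAsub : A ⊆ Finset.Icc 1 ℓ := by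
    refine Finset.image_subset_iff.2 fun i hi => ?_
    exact Finset.mem_Icc.2 (ha.mapsTo (hsub hi))
  have hAcard : A.card = s - 1 := by
    rw [hA, Finset.card_image_of_injOn (ha.injOn.mono hsub), Nat.card_Icc, Nat.add_sub_cancel]
  have hcount : Nat.count p ℓ = ℓ - s + 1 := by
    rw [count_mod_add_one_notMem hAsub, hAcard]
    omega
  obtain ⟨hx1, hxn, hpx⟩ := (hP x).1 hx
  have hpx' : p (x - 1 + ℓ) := (hper (x - 1)).symm ▸ hpx
  have hiter := cyclicSucc_iterate_nth (Nat.mul_pos hd hl) hpern (hper.infinite_setOf hl hpx) hP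
    (Nat.count p (x - 1)) (ℓ - s + 1)
  rw [← hcount, ← hper.count_add, Nat.nth_count hpx, Nat.nth_count hpx', hcount,
    Nat.mod_eq_of_lt (by omega), Nat.sub_add_cancel hx1] at hiter
  rw [hiter, shiftMod, Nat.sub_add_comm hx1]
end
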